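/- arXiv:1507.06078 — 5 statements merged into one kernel-verified Lean document; each statement's English description precedes it below -/
import Mathlib

section
/- Under the G₁-Assumption, and assuming min_{i≤k} D_{ii} > 0, the accuracy measure satisfies δ_k(Y) ≤ ((max_{i>m} D_{ii})/(min_{i≤k} D_{ii})) · max_{1≤i≤n−m} ‖e_iᵀ G₂ G₁† E_k‖₂. -/
open Matrix

namespace ARR

/-- Euclidean norm of the `i`-th row of a matrix. -/
noncomputable def rowNorm {R C : Type*} [Fintype C] (M : Matrix R C ℝ) (i : R) : ℝ :=
  Real.sqrt (∑ j, M i j ^ 2)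

/-- Supremum of `f` over indices satisfying `P`. -/
noncomputable def supOver {n : ℕ} (P : Fin n → Prop) (f : Fin n → ℝ) : ℝ :=
  sSup (f '' {i | P i})

/-- Infimum of `f` over indices satisfying `P`. -/
noncomputable def infOver {n : ℕ} (P : Fin n → Prop) (f : Fin n → ℝ) : ℝ :=
  sInf (f '' {i | P i})

/-- The accuracy measure `δₖ(Z) = max_{i>k} ‖qᵢᵀZ‖ / min_{i≤k} ‖qᵢᵀZ‖`
(indices are 1-based in the paper; here `i > k` means `k ≤ i` for 0-based `i`). -/
noncomputable def deltaK {n k : ℕ} (Q : Matrix (Fin n) (Fin n) ℝ)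
    (Z : Matrix (Fin n) (Fin k) ℝ) : ℝ :=
  supOver (fun i => k ≤ (i : ℕ)) (rowNorm (Qᵀ * Z)) /
    infOver (fun i => (i : ℕ) < k) (rowNorm (Qᵀ * Z))

/-- `Γ_{k,m}(M) = max_{i>m} ‖eᵢᵀM‖ / min_{i≤k} ‖eᵢᵀM‖`. -/
noncomputable def gammaKM {n : ℕ} {C : Type*} [Fintype C] (k m : ℕ)
    (M : Matrix (Fin n) C ℝ) : ℝ :=
  supOver (fun i => m ≤ (i : ℕ)) (rowNorm M) / infOver (fun i => (i : ℕ) < k) (rowNorm M)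

/-- Spectral (operator 2-) norm of a matrix. -/
noncomputable def specNorm {a b : Type*} [Fintype a] [Fintype b] [DecidableEq b]
    (M : Matrix a b ℝ) : ℝ :=
  ‖LinearMap.toContinuousLinearMap (Matrix.toEuclideanLin M)‖

/-- The Vandermonde matrix `V` with `V i j = λᵢ^j`, `0 ≤ j ≤ p`. -/
def vand {n : ℕ} (lam : Fin n → ℝ) (p : ℕ) : Matrix (Fin n) (Fin (p + 1)) ℝ :=
  fun i j => lam i ^ (j : ℕ)

/-- The diagonal of `D`: `Dᵢᵢ = ‖qᵢᵀX‖₂ ⬝ ‖eᵢᵀV‖₂` (the norm of the `i`-th row of `Ĝ`). -/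
noncomputable def dvec {n k : ℕ} (lam : Fin n → ℝ) (p : ℕ) (Q : Matrix (Fin n) (Fin n) ℝ)
    (X : Matrix (Fin n) (Fin k) ℝ) : Fin n → ℝ :=
  fun i => rowNorm (Qᵀ * X) i * rowNorm (vand lam p) i

/-- `G = D† Ĝ`, where `Ĝ = [QᵀX, ΛQᵀX, …, ΛᵖQᵀX]`; the column block index is `j.1`. -/
noncomputable def gmat {n k : ℕ} (lam : Fin n → ℝ) (p : ℕ) (Q : Matrix (Fin n) (Fin n) ℝ)
    (X : Matrix (Fin n) (Fin k) ℝ) : Matrix (Fin n) (Fin (p + 1) × Fin k) ℝ :=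
  fun i j => (dvec lam p Q X i)⁻¹ * (lam i ^ (j.1 : ℕ) * (Qᵀ * X) i j.2)

/-- The augmented matrix `X_p = [X, AX, …, AᵖX]`; the column block index is `j.1`. -/
noncomputable def aug {n k : ℕ} (A : Matrix (Fin n) (Fin n) ℝ)
    (X : Matrix (Fin n) (Fin k) ℝ) (p : ℕ) : Matrix (Fin n) (Fin (p + 1) × Fin k) ℝ :=
  fun i j => (A ^ (j.1 : ℕ) * X) i j.2

/-- First `m` rows of a matrix. -/
def topRows {n : ℕ} {C : Type*} (m : ℕ) (hmn : m ≤ n) (M : Matrix (Fin n) C ℝ) :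
    Matrix (Fin m) C ℝ :=
  fun i j => M (Fin.castLE hmn i) j

/-- Last `n - m` rows of a matrix. -/
def lowRows {n : ℕ} {C : Type*} (m : ℕ) (hmn : m ≤ n) (M : Matrix (Fin n) C ℝ) :
    Matrix (Fin (n - m)) C ℝ :=
  fun i j => M ⟨m + (i : ℕ), by have := i.isLt; omega⟩ j

/-- First `m` columns of a square matrix (`Q_m`). -/
def colsTop {n : ℕ} (m : ℕ) (hmn : m ≤ n) (M : Matrix (Fin n) (Fin n) ℝ) :
    Matrix (Fin n) (Fin m) ℝ :=
  fun i j => M i (Fin.castLE hmn j)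

/-- Last `n - m` columns of a square matrix (`Q_{m+}`). -/
def colsLow {n : ℕ} (m : ℕ) (hmn : m ≤ n) (M : Matrix (Fin n) (Fin n) ℝ) :
    Matrix (Fin n) (Fin (n - m)) ℝ :=
  fun i j => M i ⟨m + (j : ℕ), by have := j.isLt; omega⟩

/-- `E_k`: the first `k` columns of the `m × m` identity matrix. -/
def ekMat (m k : ℕ) : Matrix (Fin m) (Fin k) ℝ :=
  fun i j => if (i : ℕ) = (j : ℕ) then 1 else 0

/-- `D₁⁻¹`: the inverse of the leading `m × m` block of `D`. -/
noncomputable def d1inv {n : ℕ} (m : ℕ) (hmn : m ≤ n) (d : Fin n → ℝ) :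
    Matrix (Fin m) (Fin m) ℝ :=
  Matrix.diagonal fun i => (d (Fin.castLE hmn i))⁻¹

/-- `D₂`: the trailing `(n-m) × (n-m)` block of `D`. -/
noncomputable def d2mat {n : ℕ} (m : ℕ) (hmn : m ≤ n) (d : Fin n → ℝ) :
    Matrix (Fin (n - m)) (Fin (n - m)) ℝ :=
  Matrix.diagonal fun i => d ⟨m + (i : ℕ), by have := i.isLt; omega⟩

/-- `Y = X_p G₁† D₁⁻¹ E_k`, where `A = Q Λ Qᵀ` and `X_p = [X, AX, …, AᵖX]`. -/
noncomputable def ymat {n k : ℕ} (m : ℕ) (hmn : m ≤ n) (lam : Fin n → ℝ) (p : ℕ)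
    (Q : Matrix (Fin n) (Fin n) ℝ) (X : Matrix (Fin n) (Fin k) ℝ)
    (Gpinv : Matrix (Fin (p + 1) × Fin k) (Fin m) ℝ) : Matrix (Fin n) (Fin k) ℝ :=
  aug (Q * Matrix.diagonal lam * Qᵀ) X p * Gpinv * d1inv m hmn (dvec lam p Q X) * ekMat m k

end ARR

namespace ARR

section

variable {n : ℕ} {R R' C : Type*} [Fintype C]

lemma rowNorm_nonneg (M : Matrix R C ℝ) (i : R) : 0 ≤ rowNorm M i :=
  Real.sqrt_nonneg _

lemma abs_le_rowNorm (M : Matrix R C ℝ) (i : R) (j : C) : |M i j| ≤ rowNorm M i := by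
  rw [rowNorm, ← Real.sqrt_sq_eq_abs]
  exact Real.sqrt_le_sqrt
    (Finset.single_le_sum (f := fun j => M i j ^ 2) (fun _ _ => sq_nonneg _) (Finset.mem_univ j))

lemma rowNorm_le_mul_rowNorm {M : Matrix R C ℝ} {N : Matrix R' C ℝ} {i : R} {i' : R'} {c : ℝ}
    (hc : 0 ≤ c) (h : ∀ j, |M i j| ≤ c * |N i' j|) : rowNorm M i ≤ c * rowNorm N i' := by
  rw [rowNorm, rowNorm, ← Real.sqrt_sq hc, ← Real.sqrt_mul (sq_nonneg c), Finset.mul_sum]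
  refine Real.sqrt_le_sqrt (Finset.sum_le_sum fun j _ => ?_)
  rw [← sq_abs (M i j), ← sq_abs (N i' j), ← mul_pow]
  exact pow_le_pow_left₀ (abs_nonneg _) (h j) 2

lemma le_supOver {P : Fin n → Prop} (f : Fin n → ℝ) {i : Fin n} (hi : P i) :
    f i ≤ supOver P f :=
  le_csSup (Set.toFinite _).bddAbove (Set.mem_image_of_mem f hi)

lemma infOver_le {P : Fin n → Prop} (f : Fin n → ℝ) {i : Fin n} (hi : P i) :
    infOver P f ≤ f i :=
  csInf_le (Set.toFinite _).bddBelow (Set.mem_image_of_mem f hi)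

lemma supOver_nonneg (P : Fin n → Prop) {f : Fin n → ℝ} (hf : ∀ i, 0 ≤ f i) :
    0 ≤ supOver P f := by
  refine Real.sSup_nonneg ?_
  rintro _ ⟨i, -, rfl⟩
  exact hf i

lemma supOver_le {P : Fin n → Prop} {f : Fin n → ℝ} {b : ℝ} (hb : 0 ≤ b)
    (h : ∀ i, P i → f i ≤ b) : supOver P f ≤ b := by
  refine Real.sSup_le ?_ hb
  rintro _ ⟨i, hi, rfl⟩
  exact h i hi

lemma infOver_eq_of_forall_eq {P : Fin n → Prop} {f : Fin n → ℝ} {b : ℝ} (hP : ∃ i, P i)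
    (h : ∀ i, P i → f i = b) : infOver P f = b := by
  have himage : f '' {i | P i} = {b} := by
    ext x
    constructor
    · rintro ⟨i, hi, rfl⟩
      exact h i hi
    · rintro rfl
      obtain ⟨i, hi⟩ := hP
      exact ⟨i, hi, h i hi⟩
  rw [infOver, himage, csInf_singleton]

end

variable {n k m p : ℕ}

lemma one_le_rowNorm_vand (lam : Fin n → ℝ) (p : ℕ) (i : Fin n) : 1 ≤ rowNorm (vand lam p) i := by
  simpa [vand] using abs_le_rowNorm (vand lam p) i 0

lemma dvec_nonneg (lam : Fin n → ℝ) (p : ℕ) (Q : Matrix (Fin n) (Fin n) ℝ)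
    (X : Matrix (Fin n) (Fin k) ℝ) (i : Fin n) : 0 ≤ dvec lam p Q X i :=
  mul_nonneg (rowNorm_nonneg _ _) (rowNorm_nonneg _ _)

lemma transpose_mul_conj_pow (lam : Fin n → ℝ) {Q : Matrix (Fin n) (Fin n) ℝ}
    (hQ' : Qᵀ * Q = 1) (j : ℕ) :
    Qᵀ * (Q * diagonal lam * Qᵀ) ^ j = diagonal (fun i => lam i ^ j) * Qᵀ := by
  induction j with
  | zero => simp
  | succ j ih =>
    have hconj : Qᵀ * (Q * diagonal lam * Qᵀ) = diagonal lam * Qᵀ := by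
      rw [Matrix.mul_assoc, ← Matrix.mul_assoc Qᵀ, hQ', Matrix.one_mul]
    rw [pow_succ, ← Matrix.mul_assoc, ih, Matrix.mul_assoc, hconj, ← Matrix.mul_assoc,
      diagonal_mul_diagonal]
    simp only [pow_succ]

lemma transpose_mul_aug (lam : Fin n → ℝ) {Q : Matrix (Fin n) (Fin n) ℝ} (hQ' : Qᵀ * Q = 1)
    (X : Matrix (Fin n) (Fin k) ℝ) :
    Qᵀ * aug (Q * diagonal lam * Qᵀ) X p = diagonal (dvec lam p Q X) * gmat lam p Q X := by
  ext i j
  have hentry : (Qᵀ * aug (Q * diagonal lam * Qᵀ) X p) i j =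
      lam i ^ (j.1 : ℕ) * (Qᵀ * X) i j.2 := by
    change (Qᵀ * ((Q * diagonal lam * Qᵀ) ^ (j.1 : ℕ) * X)) i j.2 = _
    rw [← Matrix.mul_assoc, transpose_mul_conj_pow lam hQ', Matrix.mul_assoc, diagonal_mul]
  rw [hentry, diagonal_mul, gmat]
  by_cases hd : dvec lam p Q X i = 0
  · have hnorm : rowNorm (Qᵀ * X) i = 0 :=
      (mul_eq_zero.mp hd).resolve_right
        (zero_lt_one.trans_le (one_le_rowNorm_vand lam p i)).ne'
    have hzero : (Qᵀ * X) i j.2 = 0 :=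
      abs_nonpos_iff.mp (hnorm ▸ abs_le_rowNorm (Qᵀ * X) i j.2)
    simp [hzero]
  · rw [mul_inv_cancel_left₀ hd]

lemma mul_ekMat_apply {R : Type*} (hkm : k ≤ m) (M : Matrix R (Fin m) ℝ) (i : R) (c : Fin k) :
    (M * ekMat m k) i c = M i (Fin.castLE hkm c) := by
  rw [Matrix.mul_apply, Finset.sum_eq_single (Fin.castLE hkm c)]
  · simp [ekMat]
  · intro b _ hb
    have hbc : (b : ℕ) ≠ c := fun h => hb (Fin.ext h)
    simp [ekMat, hbc]
  · simp

lemma transpose_mul_ymat_apply (hkm : k ≤ m) (hmn : m ≤ n) (lam : Fin n → ℝ)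
    {Q : Matrix (Fin n) (Fin n) ℝ} (hQ' : Qᵀ * Q = 1) (X : Matrix (Fin n) (Fin k) ℝ)
    (Gpinv : Matrix (Fin (p + 1) × Fin k) (Fin m) ℝ) (i : Fin n) (c : Fin k) :
    (Qᵀ * ymat m hmn lam p Q X Gpinv) i c =
      dvec lam p Q X i * (gmat lam p Q X * Gpinv) i (Fin.castLE hkm c) *
        (dvec lam p Q X (Fin.castLE (hkm.trans hmn) c))⁻¹ := by
  rw [ymat, ← Matrix.mul_assoc, mul_ekMat_apply hkm, ← Matrix.mul_assoc, d1inv, mul_diagonal,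
    ← Matrix.mul_assoc, transpose_mul_aug lam hQ', Matrix.mul_assoc, diagonal_mul]
  rfl

end ARR

open ARR in
/-- Lemma 3.2 of the paper. Under the `G₁`-Assumption and positivity of
`min_{i≤k} Dᵢᵢ`, `δₖ(Y) ≤ (max_{i>m} Dᵢᵢ / min_{i≤k} Dᵢᵢ) ⬝ max_{1≤i≤n-m} ‖eᵢᵀ G₂ G₁† E_k‖₂`. -/
theorem arr_lemma_deltaY_bound {n k p m : ℕ} (hk : 0 < k) (hn : (p + 1) * k < n)
    (hkm : k ≤ m) (hmk : m ≤ k + p * k) (hmn : m ≤ n)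
    (lam : Fin n → ℝ) (hlam : Antitone lam)
    (Q : Matrix (Fin n) (Fin n) ℝ) (hQ : Q * Qᵀ = 1) (hQ' : Qᵀ * Q = 1)
    (X : Matrix (Fin n) (Fin k) ℝ)
    (Gpinv : Matrix (Fin (p + 1) × Fin k) (Fin m) ℝ)
    (hG1 : topRows m hmn (gmat lam p Q X) * Gpinv = 1)
    (hdpos : 0 < infOver (fun i => (i : ℕ) < k) (dvec lam p Q X)) :
    deltaK Q (ymat m hmn lam p Q X Gpinv) ≤
      (supOver (fun i => m ≤ (i : ℕ)) (dvec lam p Q X) /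
          infOver (fun i => (i : ℕ) < k) (dvec lam p Q X)) *
        sSup (Set.range (rowNorm (lowRows m hmn (gmat lam p Q X) * Gpinv * ekMat m k))) := by
  set d := dvec lam p Q X with hd
  have hd_nonneg : ∀ i, 0 ≤ d i := dvec_nonneg lam p Q X
  have hd_ge : ∀ c : Fin k, infOver (fun i => (i : ℕ) < k) d ≤ d (Fin.castLE (hkm.trans hmn) c) :=
    fun c => infOver_le d (P := fun i => (i : ℕ) < k) c.isLt
  have hentry := transpose_mul_ymat_apply hkm hmn lam hQ' X Gpinv
  rw [← hd] at hentry
  have htop : ∀ (i : Fin n) (hi : (i : ℕ) < m) (j : Fin m),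
      (gmat lam p Q X * Gpinv) i j = if (i : ℕ) = j then 1 else 0 := by
    intro i hi j
    have h := congrFun (congrFun hG1 ⟨i, hi⟩) j
    simp only [Matrix.one_apply, Fin.ext_iff] at h
    exact h
  have hrow_one : ∀ i : Fin n, (i : ℕ) < k →
      rowNorm (Qᵀ * ymat m hmn lam p Q X Gpinv) i = 1 := by
    intro i hi
    rw [rowNorm, Finset.sum_eq_single ⟨i, hi⟩]
    · have hne : d i ≠ 0 := (hdpos.trans_le (hd_ge ⟨i, hi⟩)).ne'
      rw [hentry, htop i (hi.trans_le hkm)]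
      simp [hne]
    · intro c _ hc
      have hic : (i : ℕ) ≠ c := fun h => hc (Fin.ext h.symm)
      rw [hentry, htop i (hi.trans_le hkm)]
      simp [hic]
    · simp
  set N := lowRows m hmn (gmat lam p Q X) * Gpinv * ekMat m k with hN
  have hsup_nonneg : 0 ≤ supOver (fun i => m ≤ (i : ℕ)) d := supOver_nonneg _ hd_nonneg
  have hrange_nonneg : 0 ≤ sSup (Set.range (rowNorm N)) := by
    refine Real.sSup_nonneg ?_
    rintro _ ⟨i, rfl⟩
    exact rowNorm_nonneg N i
  rw [deltaK, infOver_eq_of_forall_eq ⟨⟨0, by omega⟩, hk⟩ hrow_one, div_one]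
  have hbound_nonneg := mul_nonneg (div_nonneg hsup_nonneg hdpos.le) hrange_nonneg
  refine supOver_le hbound_nonneg fun i hi => ?_
  rcases lt_or_ge (i : ℕ) m with him | him
  · refine le_trans (le_of_eq ?_) hbound_nonneg
    rw [rowNorm, Finset.sum_eq_zero, Real.sqrt_zero]
    intro c _
    have hic : (i : ℕ) ≠ c := by omega
    rw [hentry, htop i him]
    simp [hic]
  · let r : Fin (n - m) := ⟨i - m, by omega⟩
    have hNr : ∀ c, (gmat lam p Q X * Gpinv) i (Fin.castLE hkm c) = N r c := by
      intro c
      have hri : (⟨m + (r : ℕ), by omega⟩ : Fin n) = i := Fin.ext (Nat.add_sub_cancel' him)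
      rw [hN, mul_ekMat_apply hkm]
      simp only [Matrix.mul_apply, lowRows, hri]
    calc rowNorm (Qᵀ * ymat m hmn lam p Q X Gpinv) i
        ≤ d i / infOver (fun i => (i : ℕ) < k) d * rowNorm N r := by
          refine rowNorm_le_mul_rowNorm (div_nonneg (hd_nonneg i) hdpos.le) fun c => ?_
          rw [hentry, hNr, abs_mul, abs_mul, abs_of_nonneg (hd_nonneg i), abs_inv,
            abs_of_nonneg (hd_nonneg _), div_eq_mul_inv, mul_right_comm]
          have := hd_nonneg i
          gcongr
          exact hd_ge c
      _ ≤ _ := by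
          gcongr
          · exact rowNorm_nonneg N r
          · exact le_supOver d (P := fun i => m ≤ (i : ℕ)) him
          · exact le_csSup (Set.finite_range _).bddAbove (Set.mem_range_self r)
end

section
/- Let m ∈ (k, k+pk] for p > 0, let C ∈ ℝ^{m×k}, let Λ_m = diag(μ₁, …, μ_m) be a diagonal matrix with positive diagonal entries, and let H = [C, Λ_mC, Λ_m²C, …, Λ_m^pC] ∈ ℝ^{m×(p+1)k}. If more than k of the diagonal entries μ₁, …, μ_m are equal to a common value (i.e., Λ_m contains an eigenvalue of multiplicity greater than k), then rank(H) < m; equivalently, H has full row rank m only if no value occurs more than k times among the diagonal entries of Λ_m. -/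
open Matrix

/-- Proposition 4.1. Let `m ∈ (k, k+pk]` for `p > 0`, let
`H = [C, Λ_m C, …, Λ_m^p C]` (column block index `j.1`) where `Λ_m = diag(μ)` has positive
diagonal entries. If more than `k` of the diagonal entries of `Λ_m` are equal to a common
value `α`, then `rank H < m`; i.e. `H` has full row rank `m` only if no eigenvalue of `Λ_m`
has multiplicity greater than `k`. -/
theorem rank_deficient_of_high_multiplicity {m k p : ℕ} (hp : 0 < p) (hk : 0 < k)
    (hkm : k < m) (hmk : m ≤ k + p * k)
    (μ : Fin m → ℝ) (hμ : ∀ i, 0 < μ i)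
    (C : Matrix (Fin m) (Fin k) ℝ) (α : ℝ)
    (hmult : k < (Finset.univ.filter fun i => μ i = α).card) :
    (Matrix.of fun (i : Fin m) (j : Fin (p + 1) × Fin k) =>
        μ i ^ (j.1 : ℕ) * C i j.2).rank < m := by
  by_contra! hrank
  set H : Matrix (Fin m) (Fin (p + 1) × Fin k) ℝ :=
    Matrix.of fun i j => μ i ^ (j.1 : ℕ) * C i j.2 with hH
  have hrows : LinearIndependent ℝ H.row := by
    rw [linearIndependent_iff_card_le_finrank_span, Fintype.card_fin]
    rwa [Matrix.rank_eq_finrank_span_row] at hrank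
  let L : (Fin k → ℝ) →ₗ[ℝ] (Fin (p + 1) × Fin k → ℝ) :=
    LinearMap.pi fun j => α ^ (j.1 : ℕ) • LinearMap.proj j.2
  let s := Finset.univ.filter fun i => μ i = α
  have hsub : LinearIndependent ℝ fun i : s => H.row i :=
    hrows.comp _ Subtype.val_injective
  have hL : (fun i : s => H.row i) = L ∘ fun i : s => C.row i := by
    ext i j
    have hi : μ i = α := (Finset.mem_filter.mp i.2).2
    simp [L, hH, hi]
  rw [hL] at hsub
  have hcard := (hsub.of_comp L).fintype_card_le_finrank
  rw [Fintype.card_coe, Module.finrank_fin_fun] at hcard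
  exact hmult.not_ge hcard
end

section
/- Let p = 1 and m = 2k. Let C ∈ ℝ^{2k×k} be such that every k×k submatrix of C (formed by any k rows of C) is nonsingular, and let Λ_{2k} = diag(μ₁, …, μ_{2k}) with μ₁ ≥ μ₂ ≥ … ≥ μ_{2k} > 0. If the maximum multiplicity of the diagonal entries of Λ_{2k} equals k, then the 2k×2k matrix H = [C, Λ_{2k}C] is nonsingular. -/
open Matrix

theorem eq_zero_of_mulVec_eq_zero_on {m k : ℕ} (C : Matrix (Fin m) (Fin k) ℝ)
    (hC : ∀ s : Fin k → Fin m, Function.Injective s →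
      (Matrix.of fun i j => C (s i) j).det ≠ 0)
    (S : Finset (Fin m)) (hS : S.card = k) (w : Fin k → ℝ)
    (hw : ∀ i ∈ S, (C *ᵥ w) i = 0) : w = 0 := by
  refine Matrix.eq_zero_of_mulVec_eq_zero
    (hC (S.orderEmbOfFin hS) (S.orderEmbOfFin hS).injective) ?_
  funext i
  exact hw _ (S.orderEmbOfFin_mem hS i)

/-- Proposition 4.2. Let `p = 1`, `m = 2k`. If every `k × k` submatrix of
`C ∈ ℝ^{2k×k}` is nonsingular, `μ₁ ≥ … ≥ μ_{2k} > 0`, and the maximum multiplicity of the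
diagonal entries equals `k`, then `H = [C, Λ_{2k} C]` is nonsingular. Here `H` is realized
as the `2k × 2k` matrix whose first `k` columns are `C` and last `k` columns are `Λ_{2k}C`. -/
theorem fromBlocks_nonsingular_of_multiplicity_k {k : ℕ} (hk : 0 < k)
    (C : Matrix (Fin (2 * k)) (Fin k) ℝ)
    (hC : ∀ s : Fin k → Fin (2 * k), Function.Injective s →
      (Matrix.of fun i j => C (s i) j).det ≠ 0)
    (μ : Fin (2 * k) → ℝ) (hdec : Antitone μ) (hpos : ∀ i, 0 < μ i)
    (hmult_attained : ∃ α : ℝ, (Finset.univ.filter fun i => μ i = α).card = k)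
    (hmult_max : ∀ α : ℝ, (Finset.univ.filter fun i => μ i = α).card ≤ k) :
    (Matrix.of fun (i j : Fin (2 * k)) =>
        if h : (j : ℕ) < k then C i ⟨(j : ℕ), h⟩
        else μ i * C i ⟨(j : ℕ) - k, by have := j.isLt; omega⟩).det ≠ 0 := by
  intro hdet
  obtain ⟨v, hv0, hv⟩ := Matrix.exists_mulVec_eq_zero_iff.mpr hdet
  obtain ⟨α, hα⟩ := hmult_attained
  have two_k : k + k = 2 * k := (two_mul k).symm
  set x : Fin k → ℝ := fun j => v (Fin.cast two_k (Fin.castAdd k j)) with hx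
  set y : Fin k → ℝ := fun j => v (Fin.cast two_k (Fin.natAdd k j)) with hy
  have hrow : ∀ i, (C *ᵥ x) i + μ i * (C *ᵥ y) i = 0 := by
    intro i
    have h := congrFun hv i
    simp only [Matrix.mulVec, dotProduct, Matrix.of_apply, Pi.zero_apply] at h
    rw [← (finCongr two_k).sum_comp, Fin.sum_univ_add] at h
    simpa [Matrix.mulVec, dotProduct, hx, hy, Finset.mul_sum, mul_assoc] using h
  have hxy : x + α • y = 0 := by
    refine eq_zero_of_mulVec_eq_zero_on C hC _ hα _ fun i hi => ?_
    rw [Finset.mem_filter] at hi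
    simpa [Matrix.mulVec_add, Matrix.mulVec_smul, hi.2] using hrow i
  have hy0 : y = 0 := by
    refine eq_zero_of_mulVec_eq_zero_on C hC (Finset.univ.filter fun i => μ i = α)ᶜ ?_ _
      fun i hi => ?_
    · rw [Finset.card_compl, hα, Fintype.card_fin]
      omega
    · have hne : μ i - α ≠ 0 := sub_ne_zero.mpr (by simpa using hi)
      have h := congrFun (congrArg (C *ᵥ ·) hxy) i
      simp only [Matrix.mulVec_add, Matrix.mulVec_smul, Matrix.mulVec_zero, Pi.add_apply,
        Pi.smul_apply, Pi.zero_apply, smul_eq_mul] at h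
      refine (mul_eq_zero.mp ?_).resolve_left hne
      linear_combination hrow i - h
  have hx0 : x = 0 := by simpa [hy0] using hxy
  refine hv0 (funext fun j => ?_)
  obtain ⟨j, rfl⟩ := (finCongr two_k).surjective j
  refine Fin.addCases (fun j => ?_) (fun j => ?_) j
  · exact congrFun hx0 j
  · exact congrFun hy0 j
end

section
/- Partition C ∈ ℝ^{2k×k} as C = [C₁; C₂] with C₁, C₂ ∈ ℝ^{k×k} and assume C₁ is nonsingular; let F = C₂C₁⁻¹. Let Λ₁, Λ₂ ∈ ℝ^{k×k} be diagonal. Then the 2k×2k block matrix H = [[C₁, Λ₁C₁], [C₂, Λ₂C₂]] is nonsingular if and only if the matrix Λ₂F − FΛ₁ is nonsingular (equivalently, if and only if K = Λ₁ − F⁻¹Λ₂F is nonsingular when F is also nonsingular). -/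
open Matrix

/-- Block elimination: the Schur complement of `A` in `[[A, P * A], [B, Q * B]]` is
`(Q * F - F * P) * A`, where `F = B * A⁻¹`. -/
theorem isUnit_det_fromBlocks_mul_iff {n R : Type*} [Fintype n] [DecidableEq n] [CommRing R]
    (A B P Q : Matrix n n R) (hA : IsUnit A.det) :
    IsUnit (Matrix.fromBlocks A (P * A) B (Q * B)).det ↔
      IsUnit (Q * (B * A⁻¹) - (B * A⁻¹) * P).det := by
  have : Invertible A := Matrix.invertibleOfIsUnitDet A hA
  have hschur : Q * B - B * ⅟A * (P * A) = (Q * (B * A⁻¹) - (B * A⁻¹) * P) * A := by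
    rw [Matrix.invOf_eq_nonsing_inv, Matrix.sub_mul]
    simp only [Matrix.mul_assoc, Matrix.nonsing_inv_mul A hA, Matrix.mul_one]
  rw [Matrix.det_fromBlocks₁₁, hschur, Matrix.det_mul, IsUnit.mul_iff, IsUnit.mul_iff]
  tauto

/-- For nonsingular `F`, the matrix `Q * F - F * P` is nonsingular iff `P - F⁻¹ * Q * F` is. -/
theorem isUnit_det_mul_sub_mul_iff {n R : Type*} [Fintype n] [DecidableEq n] [CommRing R]
    (F P Q : Matrix n n R) (hF : IsUnit F.det) :
    IsUnit (Q * F - F * P).det ↔ IsUnit (P - F⁻¹ * Q * F).det := by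
  have h : Q * F - F * P = -F * (P - F⁻¹ * Q * F) := by
    rw [Matrix.neg_mul, Matrix.mul_sub, Matrix.mul_assoc F⁻¹,
      Matrix.mul_nonsing_inv_cancel_left F _ hF, neg_sub]
  have hneg : IsUnit (-F).det :=
    (Matrix.isUnit_iff_isUnit_det _).1 ((Matrix.isUnit_iff_isUnit_det F).2 hF).neg
  rw [h, Matrix.det_mul, IsUnit.mul_iff]
  exact and_iff_right hneg

/-- block elimination step in the proof of Proposition 4.2. With
`C = [C₁; C₂]`, `C₁` nonsingular, `F = C₂C₁⁻¹`, and `Λ₁, Λ₂` diagonal, the block matrix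
`H = [[C₁, Λ₁C₁], [C₂, Λ₂C₂]]` is nonsingular iff `Λ₂F − FΛ₁` is nonsingular; equivalently,
when `F` is also nonsingular, iff `K = Λ₁ − F⁻¹Λ₂F` is nonsingular. -/
theorem blockMatrix_nonsingular_iff {k : ℕ}
    (C₁ C₂ : Matrix (Fin k) (Fin k) ℝ) (l₁ l₂ : Fin k → ℝ)
    (hC₁ : IsUnit C₁.det) :
    (IsUnit (Matrix.fromBlocks C₁ (Matrix.diagonal l₁ * C₁) C₂
        (Matrix.diagonal l₂ * C₂)).det ↔
      IsUnit (Matrix.diagonal l₂ * (C₂ * C₁⁻¹) - (C₂ * C₁⁻¹) * Matrix.diagonal l₁).det) ∧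
    (IsUnit (C₂ * C₁⁻¹).det →
      (IsUnit (Matrix.fromBlocks C₁ (Matrix.diagonal l₁ * C₁) C₂
          (Matrix.diagonal l₂ * C₂)).det ↔
        IsUnit (Matrix.diagonal l₁ -
          (C₂ * C₁⁻¹)⁻¹ * Matrix.diagonal l₂ * (C₂ * C₁⁻¹)).det)) := by
  have h := isUnit_det_fromBlocks_mul_iff C₁ C₂ (Matrix.diagonal l₁) (Matrix.diagonal l₂) hC₁
  exact ⟨h, fun hF => h.trans (isUnit_det_mul_sub_mul_iff _ _ _ hF)⟩
end

section
/- Let A = QΛQᵀ with Q = [q₁, …, q_n] orthogonal and Λ = diag(λ₁, …, λ_n), λ₁ ≥ ⋯ ≥ λ_n. Let ρ: ℝ → ℝ, q ≥ 1 an integer, X₀ ∈ ℝ^{n×k}, and X = Q ρ(Λ)^q Qᵀ X₀. Assume the ordering condition |ρ(λ_{k+1})| ≥ |ρ(λ_{k+2})| ≥ ⋯ ≥ |ρ(λ_{m+1})| = max_{m<j≤n}|ρ(λ_j)| with |ρ(λ_{k+1})| > 0, and min_{j>k}‖q_jᵀX₀‖₂ > 0, where k < m < n. Then (max_{j>m}‖q_jᵀX‖₂)/(max_{j>k}‖q_jᵀX‖₂)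 ≤ |ρ(λ_{m+1})/ρ(λ_{k+1})|^q · (max_{j>m}‖q_jᵀX₀‖₂)/(min_{j>k}‖q_jᵀX₀‖₂). -/
open Matrix

/-- Euclidean norm of the `i`-th row of a matrix. -/
noncomputable def rowNorm {R C : Type*} [Fintype C] (M : Matrix R C ℝ) (i : R) : ℝ :=
  Real.sqrt (∑ j, M i j ^ 2)

/-- Supremum of `f` over indices satisfying `P`. -/
noncomputable def supOver {n : ℕ} (P : Fin n → Prop) (f : Fin n → ℝ) : ℝ :=
  sSup (f '' {i | P i})

/-- Infimum of `f` over indices satisfying `P`. -/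
noncomputable def infOver {n : ℕ} (P : Fin n → Prop) (f : Fin n → ℝ) : ℝ :=
  sInf (f '' {i | P i})

theorem rowNorm_nonneg {R C : Type*} [Fintype C] (M : Matrix R C ℝ) (i : R) : 0 ≤ rowNorm M i :=
  Real.sqrt_nonneg _

theorem rowNorm_diagonal_mul {R C : Type*} [Fintype R] [DecidableEq R] [Fintype C]
    (d : R → ℝ) (M : Matrix R C ℝ) (i : R) :
    rowNorm (Matrix.diagonal d * M) i = |d i| * rowNorm M i := by
  simp only [rowNorm, Matrix.diagonal_mul, mul_pow, ← Finset.mul_sum]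
  rw [Real.sqrt_mul (sq_nonneg _), Real.sqrt_sq_eq_abs]

theorem le_supOver {n : ℕ} {P : Fin n → Prop} (f : Fin n → ℝ) {i : Fin n} (hi : P i) :
    f i ≤ supOver P f :=
  le_csSup (Set.toFinite _).bddAbove ⟨i, hi, rfl⟩

theorem infOver_le {n : ℕ} {P : Fin n → Prop} (f : Fin n → ℝ) {i : Fin n} (hi : P i) :
    infOver P f ≤ f i :=
  csInf_le (Set.toFinite _).bddBelow ⟨i, hi, rfl⟩

theorem supOver_le {n : ℕ} {P : Fin n → Prop} {f : Fin n → ℝ} {i₀ : Fin n} (hi₀ : P i₀) {b : ℝ}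
    (h : ∀ i, P i → f i ≤ b) : supOver P f ≤ b := by
  refine csSup_le ⟨f i₀, i₀, hi₀, rfl⟩ ?_
  rintro _ ⟨i, hi, rfl⟩
  exact h i hi

/-- key estimate in the proof of Theorem 3.2. With `X = ρ(A)^q X₀`,
`A = QΛQᵀ`, under the ordering condition
`|ρ(λ_{k+1})| ≥ ⋯ ≥ |ρ(λ_{m+1})| = max_{m<j≤n}|ρ(λ_j)|` with `|ρ(λ_{k+1})| > 0` and
`min_{j>k}‖qⱼᵀX₀‖ > 0`, one has
`(max_{j>m}‖qⱼᵀX‖)/(max_{j>k}‖qⱼᵀX‖) ≤ |ρ(λ_{m+1})/ρ(λ_{k+1})|^q ⬝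
(max_{j>m}‖qⱼᵀX₀‖)/(min_{j>k}‖qⱼᵀX₀‖)`.
(0-based indices: `λ_{k+1} = lam ⟨k⟩`, `λ_{m+1} = lam ⟨m⟩`.) -/
theorem ratio_filtered_bound {n k m q : ℕ} (hq : 1 ≤ q) (hkm : k < m) (hmn : m < n)
    (lam : Fin n → ℝ) (hlam : Antitone lam)
    (Q : Matrix (Fin n) (Fin n) ℝ) (hQ : Qᵀ * Q = 1) (hQ' : Q * Qᵀ = 1)
    (ρ : ℝ → ℝ) (X₀ X : Matrix (Fin n) (Fin k) ℝ)
    (hX : X = Q * (Matrix.diagonal fun i => ρ (lam i)) ^ q * Qᵀ * X₀)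
    (horddec : ∀ i j : Fin n, k ≤ (i : ℕ) → (i : ℕ) ≤ (j : ℕ) → (j : ℕ) ≤ m →
      |ρ (lam j)| ≤ |ρ (lam i)|)
    (hordmax : ∀ j : Fin n, m ≤ (j : ℕ) → |ρ (lam j)| ≤ |ρ (lam ⟨m, hmn⟩)|)
    (hρ : ρ (lam ⟨k, by omega⟩) ≠ 0)
    (hX₀ : 0 < infOver (fun j => k ≤ (j : ℕ)) (rowNorm (Qᵀ * X₀))) :
    supOver (fun j => m ≤ (j : ℕ)) (rowNorm (Qᵀ * X)) /
        supOver (fun j => k ≤ (j : ℕ)) (rowNorm (Qᵀ * X)) ≤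
      |ρ (lam ⟨m, hmn⟩) / ρ (lam ⟨k, by omega⟩)| ^ q *
        (supOver (fun j => m ≤ (j : ℕ)) (rowNorm (Qᵀ * X₀)) /
          infOver (fun j => k ≤ (j : ℕ)) (rowNorm (Qᵀ * X₀))) := by
  have hrow : ∀ j, rowNorm (Qᵀ * X) j = |ρ (lam j)| ^ q * rowNorm (Qᵀ * X₀) j := by
    intro j
    have hQX : Qᵀ * X = Matrix.diagonal (fun i => ρ (lam i) ^ q) * (Qᵀ * X₀) := by
      rw [hX, Matrix.diagonal_pow]
      simp only [← Matrix.mul_assoc, hQ, Matrix.one_mul]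
      rfl
    rw [hQX, rowNorm_diagonal_mul, abs_pow]
  have hnum : supOver (fun j => m ≤ (j : ℕ)) (rowNorm (Qᵀ * X)) ≤
      |ρ (lam ⟨m, hmn⟩)| ^ q * supOver (fun j => m ≤ (j : ℕ)) (rowNorm (Qᵀ * X₀)) := by
    refine supOver_le (i₀ := ⟨m, hmn⟩) le_rfl fun j hj => ?_
    rw [hrow]
    exact mul_le_mul (pow_le_pow_left₀ (abs_nonneg _) (hordmax j hj) q)
      (le_supOver (P := fun j : Fin n => m ≤ (j : ℕ)) _ hj) (rowNorm_nonneg _ _) (by positivity)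
  have hden : |ρ (lam ⟨k, by omega⟩)| ^ q *
      infOver (fun j => k ≤ (j : ℕ)) (rowNorm (Qᵀ * X₀)) ≤
        supOver (fun j => k ≤ (j : ℕ)) (rowNorm (Qᵀ * X)) := by
    have hk : (fun j : Fin n => k ≤ (j : ℕ)) ⟨k, by omega⟩ := le_rfl
    refine le_trans ?_ (le_supOver _ hk)
    rw [hrow]
    exact mul_le_mul_of_nonneg_left (infOver_le _ hk) (by positivity)
  have hsup : 0 ≤ supOver (fun j => m ≤ (j : ℕ)) (rowNorm (Qᵀ * X₀)) :=
    (rowNorm_nonneg _ _).trans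
      (le_supOver (P := fun j : Fin n => m ≤ (j : ℕ)) _ (i := ⟨m, hmn⟩) le_rfl)
  have hρk := abs_pos.mpr hρ
  rw [abs_div, div_pow, div_mul_div_comm]
  exact div_le_div₀ (by positivity) hnum (by positivity) hden
end
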